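/- Let K and L be star-shaped bodies with respect to the origin in ℝ⁴, having countably many diameters, such that K has a diameter d_K(ζ) containing the origin and parallel to ζ ∈ S³, and such that for every w ∈ S²(ζ) the sections K ∩ w^⊥ and L ∩ w^⊥ are directly congruent and have no (ζ, π)-symmetries and no (u, π)-symmetries for any u ∈ ζ^⊥ ∩ w^⊥ ∩ S³. Then there exists a vector a ∈ ℝ⁴, parallel to ζ, such that the body L̃ = L + a is star-shaped with respect to the origin and d_K(ζ) = d_{L̃}(ζ). -/

import Mathlib

noncomputable section

open scoped RealInnerProductSpace

/-- `ℝ⁴` as a Euclidean space. -/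
abbrev E4 := EuclideanSpace ℝ (Fin 4)

/-- The unit sphere `S³` in `ℝ⁴`. -/
def sph : Set E4 := Metric.sphere (0 : E4) 1

/-- The great subsphere `S²(w) = {θ ∈ S³ : θ·w = 0}`. -/
def S2 (w : E4) : Set E4 := {θ ∈ sph | ⟪θ, w⟫ = 0}

/-- The orthogonal transformation `𝒪` determined by `ζ`: for a unit vector `ζ` the map
`x ↦ 2⟪x,ζ⟫ζ - x` satisfies `𝒪 ζ = ζ` and `𝒪 = -I` on `ζ^⊥`. -/
def Ocal (ζ x : E4) : E4 := (2 * ⟪x, ζ⟫) • ζ - x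

/-- `φ` is (the extension to `ℝ⁴` of) an element of `SO(3, S²(w))`:
a linear isometry of `ℝ⁴` fixing `w`, of determinant `1`, i.e. a rotation
of the `3`-dimensional subspace `w^⊥`. -/
def IsRot (w : E4) (φ : E4 ≃ₗᵢ[ℝ] E4) : Prop :=
  φ w = w ∧ LinearMap.det (φ.toLinearEquiv : E4 →ₗ[ℝ] E4) = 1

/-- `φ ∈ SO(3, S²(w))` is a rotation by the angle `α·π` around the axis `u ∈ S²(w)`:
it fixes `w` and `u`, and turns the plane orthogonal to `w` and `u` by the angle `α·π`. -/
def IsRotAngleAbout (w u : E4) (α : ℝ) (φ : E4 ≃ₗᵢ[ℝ] E4) : Prop :=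
  IsRot w φ ∧ φ u = u ∧
    ∀ v : E4, ⟪v, w⟫ = 0 → ⟪v, u⟫ = 0 →
      ⟪φ v, v⟫ = Real.cos (α * Real.pi) * ⟪v, v⟫

/-- A body: a compact set which is the closure of its nonempty interior. -/
def IsBody (K : Set E4) : Prop := IsCompact K ∧ (interior K).Nonempty ∧ K = closure (interior K)

/-- `K` is star-shaped with respect to the origin. -/
def StarShapedO (K : Set E4) : Prop := ∀ x ∈ K, ∀ t : ℝ, t ∈ Set.Icc (0:ℝ) 1 → t • x ∈ K

/-- The radial function of `K`: `ρ_K(x) = max {c : c • x ∈ K}`. -/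
def radialFn (K : Set E4) (x : E4) : ℝ := sSup {c : ℝ | c • x ∈ K}

/-- A star body with respect to the origin: a body, star-shaped with respect to the
origin, with continuous radial function. -/
def IsStarBody (K : Set E4) : Prop := IsBody K ∧ StarShapedO K ∧ ContinuousOn (radialFn K) sph

/-- The supremum of lengths of segments contained in `K`. -/
def chordSup (K : Set E4) : ℝ := sSup {d : ℝ | ∃ z y : E4, segment ℝ z y ⊆ K ∧ d = dist z y}

/-- A diameter of the star body `K`: a segment `[z, y] ⊆ K` of maximal length. -/
def IsDiamStar (K : Set E4) (z y : E4) : Prop := segment ℝ z y ⊆ K ∧ dist z y = chordSup K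

/-- `K` has countably many diameters. -/
def CountablyManyDiamsStar (K : Set E4) : Prop := {p : E4 × E4 | IsDiamStar K p.1 p.2}.Countable

/-- Directions of diameters of the star body `K`. -/
def starDiamDirs (K : Set E4) : Set E4 :=
  {θ ∈ sph | ∃ z y : E4, IsDiamStar K z y ∧ y - z = dist z y • θ}

/-- The section `K ∩ w^⊥`. -/
def sect (w : E4) (K : Set E4) : Set E4 := {x ∈ K | ⟪x, w⟫ = 0}

/-- Subsets `D₁`, `D₂` of `w^⊥` are directly congruent:
`φ(D₁) = D₂ + a` for some rotation `φ ∈ SO(3, w^⊥)` and some `a ∈ w^⊥`. -/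
def DirCong (w : E4) (D₁ D₂ : Set E4) : Prop :=
  ∃ φ : E4 ≃ₗᵢ[ℝ] E4, IsRot w φ ∧
    ∃ a : E4, ⟪a, w⟫ = 0 ∧ φ '' D₁ = (fun x => x + a) '' D₂

/-- The subset `D` of the `3`-dimensional subspace `w^⊥` has a `(u, π)`-symmetry. -/
def HasPiSymSet (w u : E4) (D : Set E4) : Prop :=
  ∃ φ : E4 ≃ₗᵢ[ℝ] E4, IsRotAngleAbout w u 1 φ ∧
    ∃ a : E4, ⟪a, w⟫ = 0 ∧ φ '' D = (fun x => x + a) '' D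

/-- The set `Ω^r = {w ∈ S²(ζ) : (A_K ∪ A_L) ∩ S²(w) = {±ζ}}`. -/
def OmegaR (K L : Set E4) (ζ : E4) : Set E4 :=
  {w ∈ S2 ζ | (starDiamDirs K ∪ starDiamDirs L) ∩ S2 w = {ζ, -ζ}}

/-- The point of the hyperplane orthogonal to `F 3` with coordinates `c ∈ ℝ` along `F 0` and
`v ∈ ℂ` in the plane of `F 1`, `F 2`. -/
def cyl (F : Fin 4 → E4) (c : ℝ) (v : ℂ) : E4 := c • F 0 + v.re • F 1 + v.im • F 2

/-- The map `(c, v) ↦ (ε c + δ, m v)` in the coordinates `cyl F` sends `A` into `B`. -/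
def Carries (F : Fin 4 → E4) (A B : Set E4) (ε δ : ℝ) (m : ℂ → ℂ) : Prop :=
  ∀ c v, cyl F c v ∈ A → cyl F (ε * c + δ) (m v) ∈ B

lemma inner_cyl (F : OrthonormalBasis (Fin 4) ℝ E4) (c : ℝ) (v : ℂ) (i : Fin 4) :
    ⟪cyl F c v, F i⟫ = ![c, v.re, v.im, 0] i := by
  fin_cases i <;> simp [cyl, inner_add_left, real_inner_smul_left, F.inner_eq_ite]

lemma eq_cyl_of_inner_eq_zero (F : OrthonormalBasis (Fin 4) ℝ E4) (x : E4) (hx : ⟪x, F 3⟫ = 0) :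
    x = cyl F ⟪x, F 0⟫ ⟨⟪x, F 1⟫, ⟪x, F 2⟫⟩ := by
  conv_lhs => rw [← F.sum_repr' x]
  simp only [cyl, Fin.sum_univ_four, real_inner_comm x]
  simp [hx]

lemma smul_cyl (F : Fin 4 → E4) (r c : ℝ) (v : ℂ) : r • cyl F c v = cyl F (r * c) (r * v) := by
  simp [cyl, mul_smul]

lemma continuous_cyl {Y : Type*} [TopologicalSpace Y] {F : Y → Fin 4 → E4}
    (hF : ∀ i, Continuous fun y => F y i) {c : Y → ℝ} (hc : Continuous c) {v : Y → ℂ}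
    (hv : Continuous v) : Continuous fun y => cyl (F y) (c y) (v y) :=
  ((hc.smul (hF 0)).add ((Complex.continuous_re.comp hv).smul (hF 1))).add
    ((Complex.continuous_im.comp hv).smul (hF 2))

lemma IsStarBody.zero_mem {K : Set E4} (hK : IsStarBody K) : (0 : E4) ∈ K := by
  obtain ⟨x, hx⟩ := hK.1.2.1
  simpa using hK.2.1 x (interior_subset hx) 0 (by simp)

/-- A star body is a continuous radial retract of the whole space. -/
lemma IsStarBody.exists_radial_retraction {K : Set E4} (hK : IsStarBody K) :
    ∃ N : E4 → E4, Continuous N ∧ (∀ x, N x ∈ K) ∧ (∀ x ∈ K, N x = x) ∧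
      ∀ x, ∃ r : ℝ, N x = r • x := by
  have h0 := hK.zero_mem
  have hbdd : ∀ θ ∈ sph, BddAbove {c : ℝ | c • θ ∈ K} := by
    intro θ hθ
    obtain ⟨R, hR⟩ := hK.1.1.isBounded.exists_norm_le
    refine ⟨R, fun c hc => ?_⟩
    have := hR _ hc
    rw [norm_smul, mem_sphere_zero_iff_norm.1 hθ, mul_one] at this
    exact (le_abs_self c).trans this
  have hmem : ∀ θ ∈ sph, radialFn K θ • θ ∈ K := by
    intro θ hθ
    have hcl : IsClosed {c : ℝ | c • θ ∈ K} :=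
      hK.1.1.isClosed.preimage (by fun_prop)
    exact hcl.csSup_mem ⟨0, by simpa using h0⟩ (hbdd θ hθ)
  have hnn : ∀ θ ∈ sph, 0 ≤ radialFn K θ := fun θ hθ =>
    le_csSup (hbdd θ hθ) (by simpa using h0)
  have hunit : ∀ x : E4, x ≠ 0 → ‖x‖⁻¹ • x ∈ sph := by
    intro x hx
    rw [sph, mem_sphere_zero_iff_norm, norm_smul, norm_inv, norm_norm,
      inv_mul_cancel₀ (norm_ne_zero_iff.2 hx)]
  have hself : ∀ x : E4, x ≠ 0 → ‖x‖ • ‖x‖⁻¹ • x = x := fun x hx => by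
    rw [smul_smul, mul_inv_cancel₀ (norm_ne_zero_iff.2 hx), one_smul]
  refine ⟨fun x => min ‖x‖ (radialFn K (‖x‖⁻¹ • x)) • ‖x‖⁻¹ • x, ?_, ?_, ?_, ?_⟩
  · rw [continuous_iff_continuousAt]
    intro x
    by_cases hx : x = 0
    · subst hx
      unfold ContinuousAt
      simp only [norm_zero, inv_zero, smul_zero]
      apply squeeze_zero_norm (a := fun x : E4 => ‖x‖)
      · intro y
        by_cases hy : y = 0
        · simp [hy]
        · rw [norm_smul, mem_sphere_zero_iff_norm.1 (hunit y hy), mul_one, Real.norm_eq_abs,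
            abs_of_nonneg (le_min (norm_nonneg _) (hnn _ (hunit y hy)))]
          exact min_le_left _ _
      · simpa using (continuous_norm (E := E4)).tendsto 0
    · have hc : ContinuousAt (fun y : E4 => ‖y‖⁻¹ • y) x :=
        (continuous_norm.continuousAt.inv₀ (norm_ne_zero_iff.2 hx)).smul continuousAt_id
      have hr : ContinuousAt (fun y : E4 => radialFn K (‖y‖⁻¹ • y)) x := by
        refine (hK.2.2 _ (hunit x hx)).tendsto.comp
          (tendsto_nhdsWithin_of_tendsto_nhds_of_eventually_within _ hc ?_)
        filter_upwards [isOpen_ne.mem_nhds hx] with y hy using hunit y hy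
      exact (continuous_norm.continuousAt.min hr).smul hc
  · intro x
    by_cases hx : x = 0
    · simpa [hx] using h0
    · have hθ := hunit x hx
      set θ := ‖x‖⁻¹ • x
      change min ‖x‖ (radialFn K θ) • θ ∈ K
      rcases min_choice ‖x‖ (radialFn K θ) with h | h
      · have hle := min_eq_left_iff.1 h
        have hpos : 0 < radialFn K θ := (norm_pos_iff.2 hx).trans_le hle
        have := hK.2.1 _ (hmem θ hθ) (‖x‖ / radialFn K θ)
          ⟨by positivity, (div_le_one hpos).2 hle⟩
        rw [smul_smul, div_mul_cancel₀ _ hpos.ne'] at this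
        rwa [h]
      · rw [h]
        exact hmem θ hθ
  · intro x hxK
    by_cases hx : x = 0
    · simp [hx]
    · have : ‖x‖ ≤ radialFn K (‖x‖⁻¹ • x) :=
        le_csSup (hbdd _ (hunit x hx)) (by simpa only [Set.mem_ofPred_eq, hself x hx] using hxK)
      simp only [min_eq_left this, hself x hx]
  · exact fun x => ⟨_, smul_smul _ _ _⟩

lemma isClosed_carries {Y : Type*} [TopologicalSpace Y] {A B : Set E4} (hA : IsStarBody A)
    (hB : IsClosed B) {F : Y → OrthonormalBasis (Fin 4) ℝ E4}
    (hF : ∀ i, Continuous fun y => F y i) (ε δ : ℝ) {m : Y → ℂ → ℂ}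
    (hm : Continuous fun p : Y × ℂ => m p.1 p.2) :
    IsClosed {y | Carries (F y) A B ε δ (m y)} := by
  obtain ⟨N, hN, hNA, hNid, hNr⟩ := hA.exists_radial_retraction
  have key : {y | Carries (F y) A B ε δ (m y)} = ⋂ (c : ℝ) (v : ℂ), {y |
      cyl (F y) (ε * ⟪N (cyl (F y) c v), F y 0⟫ + δ)
        (m y (⟪N (cyl (F y) c v), F y 1⟫ + ⟪N (cyl (F y) c v), F y 2⟫ * Complex.I)) ∈ B} := by
    ext y
    simp only [Set.mem_ofPred_eq, Set.mem_iInter]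
    constructor
    · intro h c v
      obtain ⟨r, hr⟩ := hNr (cyl (F y) c v)
      have h1 := hNA (cyl (F y) c v)
      rw [hr, smul_cyl] at h1 ⊢
      have := h _ _ h1
      simp only [inner_cyl]
      convert! this using 2
      congr 1
      apply Complex.ext <;> simp
    · intro h c v hcv
      have := h c v
      rw [hNid _ hcv] at this
      simp only [inner_cyl] at this
      convert! this using 2
      congr 1
      apply Complex.ext <;> simp
  rw [key]
  refine isClosed_iInter fun c => isClosed_iInter fun v => hB.preimage ?_
  have h1 : Continuous fun y => N (cyl (F y) c v) :=
    hN.comp (continuous_cyl hF continuous_const continuous_const)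
  refine continuous_cyl hF ((continuous_const.mul (h1.inner (hF 0))).add continuous_const) ?_
  exact hm.comp (continuous_id.prodMk
    ((Complex.continuous_ofReal.comp (h1.inner (hF 1))).add
      ((Complex.continuous_ofReal.comp (h1.inner (hF 2))).mul continuous_const)))

lemma orthonormal_sphericalFrame (b : OrthonormalBasis (Fin 4) ℝ E4) (s t : ℝ) :
    Orthonormal ℝ ![b 0,
      (Real.cos s * Real.cos t) • b 1 + (Real.cos s * Real.sin t) • b 2 + (-Real.sin s) • b 3,
      (-Real.sin t) • b 1 + Real.cos t • b 2,
      (Real.sin s * Real.cos t) • b 1 + (Real.sin s * Real.sin t) • b 2 + Real.cos s • b 3] := by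
  have hs := Real.sin_sq_add_cos_sq s
  have ht := Real.sin_sq_add_cos_sq t
  have hdot : ∀ x y : Fin 4 → ℝ,
      ⟪∑ i, x i • b i, ∑ i, y i • b i⟫ = x 0 * y 0 + x 1 * y 1 + x 2 * y 2 + x 3 * y 3 := by
    intro x y
    rw [b.orthonormal.inner_sum]
    simp [Fin.sum_univ_four]
  let A : Fin 4 → Fin 4 → ℝ := ![![1, 0, 0, 0],
    ![0, Real.cos s * Real.cos t, Real.cos s * Real.sin t, -Real.sin s],
    ![0, -Real.sin t, Real.cos t, 0],
    ![0, Real.sin s * Real.cos t, Real.sin s * Real.sin t, Real.cos s]]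
  have hA : ![b 0,
      (Real.cos s * Real.cos t) • b 1 + (Real.cos s * Real.sin t) • b 2 + (-Real.sin s) • b 3,
      (-Real.sin t) • b 1 + Real.cos t • b 2,
      (Real.sin s * Real.cos t) • b 1 + (Real.sin s * Real.sin t) • b 2 + Real.cos s • b 3] =
      fun i => ∑ j, A i j • b j := by
    funext i
    fin_cases i <;> simp [A, Fin.sum_univ_four]
  rw [hA, orthonormal_iff_ite]
  intro i j
  rw [hdot]
  fin_cases i <;> fin_cases j <;> simp [A] <;> grind

/-- The frame of `ℝ⁴` consisting of `b 0` and of the spherical coordinate frame in the orthogonal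
complement of `b 0`, at the point with polar angle `q.1` and azimuth `q.2`. -/
def sphericalFrame (b : OrthonormalBasis (Fin 4) ℝ E4) (q : ℝ × ℝ) :
    OrthonormalBasis (Fin 4) ℝ E4 :=
  (basisOfOrthonormalOfCardEqFinrank (orthonormal_sphericalFrame b q.1 q.2)
    (by simp)).toOrthonormalBasis
    (by rw [coe_basisOfOrthonormalOfCardEqFinrank]; exact orthonormal_sphericalFrame b q.1 q.2)

lemma coe_sphericalFrame (b : OrthonormalBasis (Fin 4) ℝ E4) (q : ℝ × ℝ) :
    ⇑(sphericalFrame b q) = ![b 0,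
      (Real.cos q.1 * Real.cos q.2) • b 1 + (Real.cos q.1 * Real.sin q.2) • b 2 +
        (-Real.sin q.1) • b 3,
      (-Real.sin q.2) • b 1 + Real.cos q.2 • b 2,
      (Real.sin q.1 * Real.cos q.2) • b 1 + (Real.sin q.1 * Real.sin q.2) • b 2 +
        Real.cos q.1 • b 3] := by
  simp [sphericalFrame]

lemma continuous_sphericalFrame (b : OrthonormalBasis (Fin 4) ℝ E4) (i : Fin 4) :
    Continuous fun q => sphericalFrame b q i := by
  simp only [coe_sphericalFrame]
  fin_cases i <;> simp <;> fun_prop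

lemma norm_exp_add_one_le (x : ℝ) : ‖(Circle.exp x : ℂ) + 1‖ ≤ |(|x| - Real.pi)| := by
  have key : ∀ y : ℝ, ‖(Circle.exp (y + Real.pi) : ℂ) + 1‖ ≤ |y| := by
    intro y
    have h : (Circle.exp (y + Real.pi) : ℂ) + 1 = -(Complex.exp (Complex.I * y) - 1) := by
      rw [Circle.coe_exp, Complex.ofReal_add, add_mul, Complex.exp_add, Complex.exp_pi_mul_I,
        mul_comm (y : ℂ)]
      ring
    rw [h, norm_neg]
    exact Real.norm_exp_I_mul_ofReal_sub_one_le
  have key' : ∀ y : ℝ, ‖(Circle.exp (y - Real.pi) : ℂ) + 1‖ ≤ |y| := by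
    intro y
    have h : Circle.exp (y - Real.pi) = Circle.exp (y + Real.pi) :=
      Circle.exp_eq_exp.2 ⟨-1, by push_cast; ring⟩
    rw [h]
    exact key y
  rcases abs_cases x with ⟨h, -⟩ | ⟨h, -⟩ <;> rw [h]
  · simpa using key (x - Real.pi)
  · rw [show -x - Real.pi = -(x + Real.pi) by ring, abs_neg]
    simpa using key' (x + Real.pi)

/-- The powers of a point of the circle come close to `-1`, unless the point has small order. -/
lemma exists_pow_near_neg_one_or_pow_eq_one {ε : ℝ} (hε : 0 < ε) :
    ∃ M : ℕ, 0 < M ∧ ∀ g : Circle, (∃ k : ℕ, ‖((g ^ k : Circle) : ℂ) + 1‖ < ε) ∨ g ^ M = 1 := by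
  obtain ⟨n, hn⟩ := exists_nat_gt (2 * Real.pi / ε)
  have hn0 : 0 < n := by
    rw [← Nat.cast_pos (α := ℝ)]
    exact lt_trans (by positivity) hn
  refine ⟨n.factorial, n.factorial_pos, fun g => ?_⟩
  obtain ⟨j, k, hk0, hkn, hjk⟩ :=
    Real.exists_int_int_abs_mul_sub_le (Complex.arg g / (2 * Real.pi)) hn0
  lift k to ℕ using hk0.le
  norm_cast at hk0 hkn
  simp only [Int.cast_natCast] at hjk
  set η : ℝ := k * (Complex.arg g / (2 * Real.pi)) - j with hη
  have hgk : g ^ k = Circle.exp (2 * Real.pi * η) := by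
    conv_lhs => rw [← Circle.exp_arg g]
    rw [← Circle.exp_nsmul]
    refine Circle.exp_eq_exp.2 ⟨j, ?_⟩
    rw [hη, nsmul_eq_mul]
    field_simp
    ring
  by_cases h0 : η = 0
  · right
    obtain ⟨d, hd⟩ := Nat.dvd_factorial hk0 hkn
    rw [hd, pow_mul, hgk, h0, mul_zero, Circle.exp_zero, one_pow]
  · left
    have hpos : 0 < |η| := abs_pos.2 h0
    set m := ⌊1 / (2 * |η|)⌋₊ with hm
    have h1 : m * |η| ≤ 1 / 2 := by
      have := Nat.floor_le (show 0 ≤ 1 / (2 * |η|) by positivity)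
      rw [le_div_iff₀ (by positivity)] at this
      linarith
    have h2 : 1 / 2 < (m + 1) * |η| := by
      have := Nat.lt_floor_add_one (1 / (2 * |η|))
      rw [div_lt_iff₀ (by positivity)] at this
      linarith
    refine ⟨k * m, ?_⟩
    rw [pow_mul, hgk, ← Circle.exp_nsmul]
    refine (norm_exp_add_one_le _).trans_lt ?_
    have hpi := Real.pi_pos
    have h3 : |m • (2 * Real.pi * η)| = 2 * Real.pi * (m * |η|) := by
      rw [nsmul_eq_mul, abs_mul, abs_mul, Nat.abs_cast, abs_of_pos Real.two_pi_pos]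
      ring
    have h4 : |η| < ε / (2 * Real.pi) := by
      refine hjk.trans_lt ?_
      rw [div_lt_div_iff₀ (by positivity) (by positivity)]
      rw [div_lt_iff₀ hε] at hn
      linarith
    rw [lt_div_iff₀ (by positivity)] at h4
    rw [h3, abs_lt]
    constructor <;> nlinarith

open unitInterval in
/-- A continuous map from a cylinder to the circle cannot rotate with opposite nonzero speeds along
the two boundary circles. -/
lemma false_of_opposite_windings (H : C(I × I, Circle)) (k : ℝ) (hk : k ≠ 0)
    (h0 : ∀ y, H (0, y) = H (0, 0) * Circle.exp (-(k * y)))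
    (h1 : ∀ y, H (1, y) = H (1, 0) * Circle.exp (k * y))
    (hper : ∀ x, H (x, 1) = H (x, 0)) : False := by
  have cov := Circle.isCoveringMap_exp
  let f : C(I, ℝ) := ⟨fun y => Complex.arg (H (0, 0)) - k * y, by fun_prop⟩
  have hf : ∀ y, H (0, y) = Circle.exp (f y) := by
    intro y
    simp only [f, ContinuousMap.coe_mk]
    rw [h0, sub_eq_add_neg, Circle.exp_add, Circle.exp_arg]
  let α := cov.liftHomotopy H f hf
  have hα : ∀ p, Circle.exp (α p) = H p := congr_fun (cov.liftHomotopy_lifts H f hf)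
  have hα0 : ∀ y, α (0, y) = f y := cov.liftHomotopy_zero H f hf
  have e1 := cov.const_of_comp (g := fun x : I => α (x, 1) - α (x, 0)) (by fun_prop) (by
    intro x x'
    simp only [Circle.exp_sub, hα, hper, div_self']) 0 1
  have e2 := cov.const_of_comp (g := fun y : I => α (1, y) - k * y) (by fun_prop) (by
    intro y y'
    simp only [Circle.exp_sub, hα, h1 y, h1 y']
    simp) 0 1
  simp only [hα0] at e1
  simp [f] at e1 e2
  apply hk
  linarith

/-- There is no continuous field of cosets of subgroups of the circle omitting `-1` in the tangent
planes of the sphere, in spherical coordinates. -/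
lemma false_of_coset_field (S : Set ((ℝ × ℝ) × Circle)) (hS : IsClosed S)
    (hne : ∀ q, ∃ u, (q, u) ∈ S) (G : ℝ × ℝ → Submonoid Circle)
    (hG : IsClosed {p : (ℝ × ℝ) × Circle | p.2 ∈ G p.1}) (hG1 : ∀ q, Circle.exp Real.pi ∉ G q)
    (hdiv : ∀ q u u', (q, u) ∈ S → (q, u') ∈ S → u' / u ∈ G q)
    (hper : ∀ s u, ((s, 2 * Real.pi), u) ∈ S ↔ ((s, 0), u) ∈ S)
    (h0 : ∀ t u, ((0, t), u) ∈ S ↔ ((0, 0), Circle.exp (2 * t) * u) ∈ S)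
    (h1 : ∀ t u, ((Real.pi, t), u) ∈ S ↔ ((Real.pi, 0), Circle.exp (-(2 * t)) * u) ∈ S) :
    False := by
  obtain ⟨ε, hε, hεG⟩ : ∃ ε > 0, ∀ q ∈ Set.Icc (0 : ℝ) Real.pi ×ˢ Set.Icc (0 : ℝ) (2 * Real.pi),
      ∀ g ∈ G q, ε ≤ ‖(g : ℂ) + 1‖ := by
    have hc : IsCompact (((Set.Icc (0 : ℝ) Real.pi ×ˢ Set.Icc (0 : ℝ) (2 * Real.pi)) ×ˢ
        (Set.univ : Set Circle)) ∩ {p : (ℝ × ℝ) × Circle | p.2 ∈ G p.1}) :=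
      ((isCompact_Icc.prod isCompact_Icc).prod isCompact_univ).inter_right hG
    obtain ⟨ε, hε, h⟩ := hc.exists_forall_le' (f := fun p : (ℝ × ℝ) × Circle => ‖(p.2 : ℂ) + 1‖)
      (a := 0) (by fun_prop) (by
        rintro ⟨q, g⟩ ⟨-, hg⟩
        refine norm_pos_iff.2 fun h => hG1 q ?_
        have : Circle.exp Real.pi = g := by
          apply Circle.ext
          rw [Circle.coe_exp, Complex.exp_pi_mul_I]
          exact (eq_neg_of_add_eq_zero_left h).symm
        rw [this]
        exact hg)
    exact ⟨ε, hε, fun q hq g hg => h (q, g) ⟨⟨hq, trivial⟩, hg⟩⟩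
  obtain ⟨M, hM, hMg⟩ := exists_pow_near_neg_one_or_pow_eq_one hε
  have hpow : ∀ q ∈ Set.Icc (0 : ℝ) Real.pi ×ˢ Set.Icc (0 : ℝ) (2 * Real.pi),
      ∀ u u', (q, u) ∈ S → (q, u') ∈ S → u' ^ M = u ^ M := by
    intro q hq u u' hu hu'
    rcases hMg (u' / u) with ⟨k, hk⟩ | h
    · exact absurd (hεG q hq _ (pow_mem (hdiv q u u' hu hu') k)) (not_le.2 hk)
    · rwa [div_pow, div_eq_one] at h
  have hpi := Real.pi_pos
  let Q : unitInterval × unitInterval → ℝ × ℝ := fun p => (Real.pi * p.1, 2 * Real.pi * p.2)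
  have hQ : ∀ p, Q p ∈ Set.Icc (0 : ℝ) Real.pi ×ˢ Set.Icc (0 : ℝ) (2 * Real.pi) := by
    rintro ⟨⟨x, hx0, hx1⟩, ⟨y, hy0, hy1⟩⟩
    refine ⟨⟨by positivity, ?_⟩, ⟨by positivity, ?_⟩⟩ <;> simp only [Q] <;> nlinarith
  have hQc : Continuous Q := by fun_prop
  choose u hu using fun p => hne (Q p)
  have hcont : Continuous fun p => u p ^ M := by
    rw [continuous_iff_isClosed]
    intro C hC
    have : (fun p => u p ^ M) ⁻¹' C =
        Prod.fst '' {x : (unitInterval × unitInterval) × Circle | (Q x.1, x.2) ∈ S ∧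
          x.2 ^ M ∈ C} := by
      ext p
      constructor
      · exact fun hp => ⟨(p, u p), ⟨hu p, hp⟩, rfl⟩
      · rintro ⟨⟨p', v⟩, ⟨hv, hvC⟩, rfl⟩
        rw [Set.mem_preimage, hpow _ (hQ p') _ _ hv (hu p')]
        exact hvC
    rw [this]
    refine isClosedMap_fst_of_compactSpace _ (IsClosed.inter (hS.preimage ?_) (hC.preimage ?_))
    · exact (hQc.comp continuous_fst).prodMk continuous_snd
    · exact continuous_snd.pow M
  refine false_of_opposite_windings ⟨_, hcont⟩ (4 * Real.pi * M) (by positivity) ?_ ?_ ?_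
  · intro y
    have h := (h0 (2 * Real.pi * y) (u (0, y))).1 (by simpa [Q] using hu (0, y))
    have h' := hpow _ (hQ (0, 0)) _ _ (hu (0, 0)) (by simpa [Q] using h)
    simp only [ContinuousMap.coe_mk]
    rw [← h', mul_pow, ← Circle.exp_nsmul, mul_comm, ← mul_assoc, ← Circle.exp_add]
    convert (one_mul _).symm
    convert Circle.exp_zero
    rw [nsmul_eq_mul]
    ring
  · intro y
    have h := (h1 (2 * Real.pi * y) (u (1, y))).1 (by simpa [Q] using hu (1, y))
    have h' := hpow _ (hQ (1, 0)) _ _ (hu (1, 0))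
      (by simpa [Q, -Circle.exp_neg] using h)
    simp only [ContinuousMap.coe_mk]
    rw [← h', mul_pow, ← Circle.exp_nsmul, mul_comm, ← mul_assoc, ← Circle.exp_add]
    convert (one_mul _).symm
    convert Circle.exp_zero
    rw [nsmul_eq_mul]
    ring
  · intro x
    exact hpow _ (hQ (x, 0)) _ _ (hu (x, 0))
      (by simpa [Q] using (hper _ _).1 (by simpa [Q] using hu (x, 1)))

lemma inner_self_smul_add_smul (F : OrthonormalBasis (Fin 4) ℝ E4) (p r : ℝ) :
    ⟪p • F 1 + r • F 2, p • F 1 + r • F 2⟫ = p ^ 2 + r ^ 2 := by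
  simp only [inner_add_left, inner_add_right, real_inner_smul_left, real_inner_smul_right,
    F.inner_eq_ite]
  simp
  ring

/-- A half-turn about the axis `e` in the hyperplane orthogonal to `w`. -/
lemma exists_halfTurn {w e : E4} (hw : ‖w‖ = 1) (he : ‖e‖ = 1) (hew : ⟪e, w⟫ = 0) :
    ∃ φ : E4 ≃ₗᵢ[ℝ] E4, IsRotAngleAbout w e 1 φ ∧
      ∀ x, ⟪x, w⟫ = 0 → φ x = (2 * ⟪x, e⟫) • e - x := by
  set U : Submodule ℝ E4 := Submodule.span ℝ {w, e} with hU
  have hwU : w ∈ U := Submodule.subset_span (by simp)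
  have heU : e ∈ U := Submodule.subset_span (by simp)
  have hfix : ∀ x ∈ U, U.reflection x = x := fun x hx =>
    Submodule.reflection_mem_subspace_eq_self hx
  have hperp : ∀ x, ⟪x, w⟫ = 0 → ⟪x, e⟫ = 0 → U.reflection x = -x := by
    intro x hxw hxe
    refine Submodule.reflection_mem_subspace_orthogonalComplement_eq_neg ?_
    rw [Submodule.mem_orthogonal]
    intro y hy
    induction hy using Submodule.span_induction with
    | mem y hy =>
      rcases hy with rfl | rfl
      · rwa [real_inner_comm]
      · rwa [real_inner_comm]
    | zero => simp
    | add y z _ _ hy hz => rw [inner_add_left, hy, hz, add_zero]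
    | smul r y _ hy => rw [real_inner_smul_left, hy, mul_zero]
  have hdim : Module.finrank ℝ U = 2 := by
    have hon : Orthonormal ℝ ![w, e] := by
      have hwe : ⟪w, e⟫ = 0 := by rwa [real_inner_comm]
      rw [orthonormal_iff_ite]
      simp [Fin.forall_fin_two, hw, he, hew, hwe]
    have hr : Set.range ![w, e] = {w, e} := by
      rw [Matrix.range_cons, Matrix.range_cons, Matrix.range_empty, Set.union_empty]
      rfl
    rw [hU, ← hr, finrank_span_eq_card hon.linearIndependent, Fintype.card_fin]
  have hdim' : Module.finrank ℝ Uᗮ = 2 := by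
    have := U.finrank_add_finrank_orthogonal
    rw [hdim, finrank_euclideanSpace_fin] at this
    omega
  refine ⟨U.reflection, ⟨⟨hfix w hwU, ?_⟩, hfix e heU, ?_⟩, ?_⟩
  · have := U.det_reflection
    rw [hdim'] at this
    simpa using this
  · intro v hvw hve
    rw [hperp v hvw hve]
    simp
  · intro x hxw
    have h1 : U.reflection (x - ⟪x, e⟫ • e) = -(x - ⟪x, e⟫ • e) := by
      apply hperp
      · simp [inner_sub_left, real_inner_smul_left, hxw, hew]
      · simp [inner_sub_left, real_inner_smul_left, he]
    rw [map_sub, map_smul, hfix e heU, sub_eq_iff_eq_add] at h1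
    rw [h1]
    module

lemma hasPiSymSet_of_forall {w e d : E4} (hw : ‖w‖ = 1) (he : ‖e‖ = 1) (hew : ⟪e, w⟫ = 0)
    (hdw : ⟪d, w⟫ = 0) (hde : ⟪d, e⟫ = 0) {D : Set E4}
    (h : ∀ x, ⟪x, w⟫ = 0 → x ∈ D → (2 * ⟪x, e⟫) • e - x + d ∈ D) :
    HasPiSymSet w e (sect w D) := by
  obtain ⟨φ, hφ, hφx⟩ := exists_halfTurn hw he hew
  refine ⟨φ, hφ, -d, by simpa using hdw, ?_⟩
  ext y
  constructor
  · rintro ⟨x, ⟨hxD, hxw⟩, rfl⟩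
    refine ⟨φ x + d, ⟨?_, ?_⟩, by simp⟩
    · rw [hφx x hxw]
      exact h x hxw hxD
    · simp [hφx x hxw, inner_add_left, inner_sub_left, real_inner_smul_left, hxw, hew, hdw]
  · rintro ⟨x, ⟨hxD, hxw⟩, rfl⟩
    have hx' : ⟪(2 * ⟪x, e⟫) • e - x + d, w⟫ = 0 := by
      simp [inner_add_left, inner_sub_left, real_inner_smul_left, hxw, hew, hdw]
    refine ⟨_, ⟨h x hxw hxD, hx'⟩, ?_⟩
    rw [hφx _ hx']
    simp only [inner_add_left, inner_sub_left, real_inner_smul_left, real_inner_self_eq_norm_sq,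
      he, hde]
    module

lemma hasPiSymSet_of_carries_neg (F : OrthonormalBasis (Fin 4) ℝ E4) {D : Set E4}
    (h : Carries F D D 1 0 fun v => -v) : HasPiSymSet (F 3) (F 0) (sect (F 3) D) := by
  refine hasPiSymSet_of_forall (d := 0) (F.norm_eq_one _) (F.norm_eq_one _)
    (by simp [F.inner_eq_ite]) (by simp) (by simp) fun x hx hxD => ?_
  rw [eq_cyl_of_inner_eq_zero F x hx] at hxD
  convert! h _ _ hxD using 1
  conv_lhs => rw [eq_cyl_of_inner_eq_zero F x hx]
  simp only [inner_cyl]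
  simp [cyl]
  module

lemma exists_hasPiSymSet_of_carries_conj (F : OrthonormalBasis (Fin 4) ℝ E4) {D : Set E4} {δ : ℝ}
    (u : Circle) (h : Carries F D D (-1) δ fun v => u * (starRingEnd ℂ) v) :
    ∃ e ∈ S2 (F 0) ∩ S2 (F 3), HasPiSymSet (F 3) e (sect (F 3) D) := by
  obtain ⟨g, rfl⟩ : ∃ g : Circle, g * g = u := by
    refine ⟨Circle.exp (Complex.arg u / 2), ?_⟩
    rw [← Circle.exp_add, add_halves, Circle.exp_arg]
  have hg : (g : ℂ).re ^ 2 + (g : ℂ).im ^ 2 = 1 := by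
    have := Circle.normSq_coe g
    rw [Complex.normSq_apply] at this
    linarith
  have he : ‖cyl F 0 g‖ = 1 := by
    rw [← sq_eq_sq₀ (norm_nonneg _) zero_le_one, one_pow, ← real_inner_self_eq_norm_sq]
    have : cyl F 0 g = (g : ℂ).re • F 1 + (g : ℂ).im • F 2 := by simp [cyl]
    rw [this, inner_self_smul_add_smul F, hg]
  have hF := fun i => inner_cyl F 0 g i
  refine ⟨cyl F 0 g, ⟨⟨?_, by simp [hF]⟩, ⟨?_, by simp [hF]⟩⟩, ?_⟩
  · exact mem_sphere_zero_iff_norm.2 he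
  · exact mem_sphere_zero_iff_norm.2 he
  · refine hasPiSymSet_of_forall (d := δ • F 0) (F.norm_eq_one _) he (by simp [hF])
      (by simp [real_inner_smul_left, F.inner_eq_ite])
      (by rw [real_inner_smul_left, real_inner_comm, hF]; simp) fun x hx hxD => ?_
    rw [eq_cyl_of_inner_eq_zero F x hx] at hxD
    convert! h _ _ hxD using 1
    have hin : ⟪x, cyl F 0 g⟫ = (g : ℂ).re * ⟪x, F 1⟫ + (g : ℂ).im * ⟪x, F 2⟫ := by
      simp [cyl, inner_add_right, real_inner_smul_right]
    rw [hin]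
    conv_lhs => rw [eq_cyl_of_inner_eq_zero F x hx]
    simp only [inner_cyl]
    simp [cyl]
    match_scalars <;> grind

lemma exists_circle_of_isRot (F : OrthonormalBasis (Fin 4) ℝ E4) {φ : E4 ≃ₗᵢ[ℝ] E4}
    (hφ : IsRot (F 3) φ) {ε : ℝ} (hε : ε ^ 2 = 1) (h0 : φ (F 0) = ε • F 0) :
    ∃ u : Circle, φ (F 1) = (u : ℂ).re • F 1 + (u : ℂ).im • F 2 ∧
      φ (F 2) = (-ε * (u : ℂ).im) • F 1 + (ε * (u : ℂ).re) • F 2 := by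
  have hperp : ∀ i, i ≠ 0 → i ≠ 3 → φ (F i) = ⟪F 1, φ (F i)⟫ • F 1 + ⟪F 2, φ (F i)⟫ • F 2 := by
    intro i hi0 hi3
    have e0 : ⟪F 0, φ (F i)⟫ = 0 := by
      have h : ⟪φ (F 0), φ (F i)⟫ = 0 := by
        rw [LinearIsometryEquiv.inner_map_map, F.inner_eq_ite, if_neg hi0.symm]
      rw [h0, real_inner_smul_left] at h
      rcases mul_eq_zero.1 h with h | h
      · simp [h] at hε
      · exact h
    have e3 : ⟪F 3, φ (F i)⟫ = 0 := by
      have h : ⟪φ (F 3), φ (F i)⟫ = 0 := by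
        rw [LinearIsometryEquiv.inner_map_map, F.inner_eq_ite, if_neg hi3.symm]
      rwa [hφ.1] at h
    conv_lhs => rw [← F.sum_repr' (φ (F i))]
    simp [Fin.sum_univ_four, e0, e3]
  have h1 := hperp 1 (by decide) (by decide)
  have h2 := hperp 2 (by decide) (by decide)
  set p := ⟪F 1, φ (F 1)⟫
  set r := ⟪F 2, φ (F 1)⟫
  set p' := ⟪F 1, φ (F 2)⟫
  set r' := ⟪F 2, φ (F 2)⟫
  have n1 : p ^ 2 + r ^ 2 = 1 := by
    have h : ⟪φ (F 1), φ (F 1)⟫ = 1 := by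
      rw [LinearIsometryEquiv.inner_map_map, F.inner_eq_ite, if_pos rfl]
    rwa [h1, inner_self_smul_add_smul F] at h
  have n2 : p' ^ 2 + r' ^ 2 = 1 := by
    have h : ⟪φ (F 2), φ (F 2)⟫ = 1 := by
      rw [LinearIsometryEquiv.inner_map_map, F.inner_eq_ite, if_pos rfl]
    rwa [h2, inner_self_smul_add_smul F] at h
  have hdet : ε * (p * r' - p' * r) = 1 := by
    have h := hφ.2
    rw [← LinearMap.det_toMatrix F.toBasis] at h
    have hM : LinearMap.toMatrix F.toBasis F.toBasis (φ.toLinearEquiv : E4 →ₗ[ℝ] E4) =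
        !![ε, 0, 0, 0; 0, p, p', 0; 0, r, r', 0; 0, 0, 0, 1] := by
      ext i j
      rw [LinearMap.toMatrix_apply]
      fin_cases j <;> simp [h0, h1, h2, hφ.1] <;>
        fin_cases i <;>
        simp
    rw [hM] at h
    simp [Matrix.det_succ_row_zero, Fin.sum_univ_succ, Fin.succAbove] at h
    linarith
  have hdet' : p * r' - p' * r = ε := by
    linear_combination ε * hdet - (p * r' - p' * r) * hε
  have hsq : (p' + ε * r) ^ 2 + (r' - ε * p) ^ 2 = 0 := by
    linear_combination n2 + ε ^ 2 * n1 - 2 * hdet + hε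
  have hp' : p' = -ε * r := by nlinarith [sq_nonneg (p' + ε * r), sq_nonneg (r' - ε * p)]
  have hr' : r' = ε * p := by nlinarith [sq_nonneg (p' + ε * r), sq_nonneg (r' - ε * p)]
  have hu : ‖(⟨p, r⟩ : ℂ)‖ = 1 := by
    rw [← sq_eq_sq₀ (norm_nonneg _) zero_le_one, ← Complex.normSq_eq_norm_sq, Complex.normSq_mk]
    linarith
  exact ⟨⟨⟨p, r⟩, mem_sphere_zero_iff_norm.2 hu⟩, h1, by rw [h2, hp', hr']⟩

/-- The rigid motion `x ↦ φ x - a` matches the sections of `K` and `L` by `w^⊥`. -/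
def MatchesSections (w : E4) (K L : Set E4) (φ : E4 ≃ₗᵢ[ℝ] E4) (a : E4) : Prop :=
  φ w = w ∧ ⟪a, w⟫ = 0 ∧ ∀ x, ⟪x, w⟫ = 0 → (x ∈ K ↔ φ x - a ∈ L)

lemma inner_map_of_fixed {w : E4} {φ : E4 ≃ₗᵢ[ℝ] E4} (h : φ w = w) (x : E4) :
    ⟪φ x, w⟫ = ⟪x, w⟫ := by
  conv_lhs => rw [← h]
  exact φ.inner_map_map x w

lemma DirCong.exists_matchesSections {w : E4} {K L : Set E4}
    (h : DirCong w (sect w K) (sect w L)) :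
    ∃ φ a, IsRot w φ ∧ MatchesSections w K L φ a := by
  obtain ⟨φ, hφ, a, ha, h⟩ := h
  refine ⟨φ, a, hφ, hφ.1, ha, fun x hx => ⟨fun hxK => ?_, fun hxL => ?_⟩⟩
  · obtain ⟨y, hy, hyx⟩ := h.subset ⟨x, ⟨hxK, hx⟩, rfl⟩
    simpa [← hyx] using hy.1
  · obtain ⟨y, hy, hyx⟩ := h.superset
      ⟨φ x - a, ⟨hxL, by rw [inner_sub_left, inner_map_of_fixed hφ.1, hx, ha, sub_zero]⟩, rfl⟩
    replace hyx : φ y = φ x := hyx.trans (sub_add_cancel _ _)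
    exact φ.injective hyx ▸ hy.1

lemma MatchesSections.symm {w : E4} {K L : Set E4} {φ : E4 ≃ₗᵢ[ℝ] E4} {a : E4}
    (h : MatchesSections w K L φ a) : MatchesSections w L K φ.symm (-φ.symm a) := by
  have hw : φ.symm w = w := by rw [LinearIsometryEquiv.symm_apply_eq, h.1]
  refine ⟨hw, by rw [inner_neg_left, inner_map_of_fixed hw, h.2.1, neg_zero], fun x hx => ?_⟩
  rw [h.2.2, sub_neg_eq_add, map_add]
  · simp
  · rw [sub_neg_eq_add, inner_add_left, inner_map_of_fixed hw, inner_map_of_fixed hw, hx, h.2.1,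
      add_zero]

lemma MatchesSections.segment_subset {w : E4} {K L : Set E4} {φ : E4 ≃ₗᵢ[ℝ] E4} {a : E4}
    (h : MatchesSections w K L φ a) {z y : E4} (hz : ⟪z, w⟫ = 0) (hy : ⟪y, w⟫ = 0)
    (hzy : segment ℝ z y ⊆ K) : segment ℝ (φ z - a) (φ y - a) ⊆ L := by
  rintro x ⟨p, q, hp, hq, hpq, rfl⟩
  have hx : p • (φ z - a) + q • (φ y - a) = φ (p • z + q • y) - a := by
    have : (p + q) • a = a := by rw [hpq, one_smul]
    rw [map_add, map_smul, map_smul]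
    nth_rw 3 [← this]
    module
  rw [hx, ← h.2.2]
  · exact hzy ⟨p, q, hp, hq, hpq, rfl⟩
  · simp [inner_add_left, real_inner_smul_left, hz, hy]

lemma dist_le_chordSup {K : Set E4} (hK : IsCompact K) {z y : E4} (h : segment ℝ z y ⊆ K) :
    dist z y ≤ chordSup K := by
  refine le_csSup ⟨Metric.diam K, ?_⟩ ⟨z, y, h, rfl⟩
  rintro _ ⟨z', y', h', rfl⟩
  exact Metric.dist_le_diam_of_mem hK.isBounded (h' (left_mem_segment ℝ z' y'))
    (h' (right_mem_segment ℝ z' y'))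

lemma exists_mem_S2_orthogonal (ζ z y : E4) : ∃ w ∈ S2 ζ, ⟪z, w⟫ = 0 ∧ ⟪y, w⟫ = 0 := by
  set U : Submodule ℝ E4 := Submodule.span ℝ (Set.range ![ζ, z, y]) with hU
  have hlt : Module.finrank ℝ U ≤ 3 := by
    exact finrank_range_le_card (R := ℝ) ![ζ, z, y]
  have hne : Uᗮ ≠ ⊥ := by
    intro hbot
    have := U.finrank_add_finrank_orthogonal
    rw [hbot, finrank_bot, finrank_euclideanSpace_fin] at this
    omega
  obtain ⟨w, hw, hw0⟩ := Submodule.exists_mem_ne_zero_of_ne_bot hne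
  rw [Submodule.mem_orthogonal] at hw
  have hin : ∀ i, ⟪![ζ, z, y] i, w⟫ = 0 := fun i => hw _ (Submodule.subset_span ⟨i, rfl⟩)
  have h0 : ⟪ζ, w⟫ = 0 := hin 0
  have h1 : ⟪z, w⟫ = 0 := hin 1
  have h2 : ⟪y, w⟫ = 0 := hin 2
  refine ⟨‖w‖⁻¹ • w, ⟨mem_sphere_zero_iff_norm.2 ?_, ?_⟩, ?_, ?_⟩
  · exact norm_smul_inv_norm (𝕜 := ℝ) hw0
  · rw [real_inner_comm, real_inner_smul_right, h0, mul_zero]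
  · rw [real_inner_smul_right, h1, mul_zero]
  · rw [real_inner_smul_right, h2, mul_zero]

lemma chordSup_le_of_forall_matchesSections {K L : Set E4} (hL : IsCompact L) (hK : K.Nonempty)
    {ζ : E4} (h : ∀ w ∈ S2 ζ, ∃ φ a, MatchesSections w K L φ a) : chordSup K ≤ chordSup L := by
  obtain ⟨x, hx⟩ := hK
  refine csSup_le ⟨_, x, x, by simpa using hx, rfl⟩ ?_
  rintro _ ⟨z, y, hzy, rfl⟩
  obtain ⟨w, hw, hzw, hyw⟩ := exists_mem_S2_orthogonal ζ z y
  obtain ⟨φ, a, hφ⟩ := h w hw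
  simpa using dist_le_chordSup hL (hφ.segment_subset hzw hyw hzy)

lemma StarShapedO.segment_subset {L : Set E4} (hL : StarShapedO L) {ζ : E4} {l h : ℝ}
    (hl : l • ζ ∈ L) (hh : h • ζ ∈ L) : segment ℝ (l • ζ) (h • ζ) ⊆ L := by
  have key : ∀ c d : ℝ, d • ζ ∈ L → 0 ≤ c * d → |c| ≤ |d| → c • ζ ∈ L := by
    intro c d hd hcd hle
    rcases eq_or_ne d 0 with rfl | hd0
    · simp only [abs_zero, abs_nonpos_iff] at hle
      rwa [hle]
    · convert! hL _ hd (c / d) ⟨?_, ?_⟩ using 1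
      · rw [smul_smul, div_mul_cancel₀ _ hd0]
      · rw [← mul_div_mul_right c d hd0]
        exact div_nonneg hcd (mul_self_nonneg d)
      · exact (le_abs_self _).trans (by rw [abs_div]; exact div_le_one_of_le₀ hle (abs_nonneg _))
  rintro x ⟨p, q, hp, hq, hpq, rfl⟩
  rw [smul_smul, smul_smul, ← add_smul]
  set c := p * l + q * h
  by_cases hc : ∃ d, (d = l ∨ d = h) ∧ 0 ≤ c * d ∧ |c| ≤ |d|
  · obtain ⟨d, rfl | rfl, h1, h2⟩ := hc
    exacts [key c _ hl h1 h2, key c _ hh h1 h2]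
  · exfalso
    refine hc ?_
    have hmin : min l h ≤ c := by
      have := mul_le_mul_of_nonneg_left (min_le_left l h) hp
      have := mul_le_mul_of_nonneg_left (min_le_right l h) hq
      have : min l h = p * min l h + q * min l h := by rw [← add_mul, hpq, one_mul]
      simp only [c]; linarith
    have hmax : c ≤ max l h := by
      have := mul_le_mul_of_nonneg_left (le_max_left l h) hp
      have := mul_le_mul_of_nonneg_left (le_max_right l h) hq
      have : max l h = p * max l h + q * max l h := by rw [← add_mul, hpq, one_mul]
      simp only [c]; linarith
    rcases le_total 0 c with h0 | h0
    · refine ⟨max l h, max_choice l h, mul_nonneg h0 (h0.trans hmax), ?_⟩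
      rwa [abs_of_nonneg h0, abs_of_nonneg (h0.trans hmax)]
    · refine ⟨min l h, min_choice l h, mul_nonneg_of_nonpos_of_nonpos h0 (hmin.trans h0), ?_⟩
      rw [abs_of_nonpos h0, abs_of_nonpos (hmin.trans h0)]
      exact neg_le_neg hmin

lemma dist_smul_smul {ζ : E4} (hζ : ‖ζ‖ = 1) (l h : ℝ) : dist (l • ζ) (h • ζ) = |h - l| := by
  rw [dist_comm, dist_eq_norm, ← sub_smul, norm_smul, hζ, mul_one, Real.norm_eq_abs]

lemma eq_of_chords_of_maximal_length {L : Set E4} (hL : IsCompact L) (hs : StarShapedO L) {ζ : E4}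
    (hζ : ‖ζ‖ = 1) {l l' : ℝ} (hl : l • ζ ∈ L) (hh : (l + chordSup L) • ζ ∈ L)
    (hl' : l' • ζ ∈ L) (hh' : (l' + chordSup L) • ζ ∈ L) : l = l' := by
  have key : ∀ m n : ℝ, m • ζ ∈ L → (n + chordSup L) • ζ ∈ L → n ≤ m := by
    intro m n hm hn
    have := dist_le_chordSup hL (hs.segment_subset hm hn)
    rw [dist_smul_smul hζ] at this
    linarith [le_abs_self (n + chordSup L - m)]
  exact le_antisymm (key _ _ hl' hh) (key _ _ hl hh')

lemma dense_setOf_orthogonal_imp_axis (b : OrthonormalBasis (Fin 4) ℝ E4) {C : Set E4}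
    (hC : C.Countable) :
    Dense {q : ℝ × ℝ | ∀ p ∈ C, ⟪p, sphericalFrame b q 3⟫ = 0 → p = ⟪p, b 0⟫ • b 0} := by
  have key : ∀ p : E4, p ≠ ⟪p, b 0⟫ • b 0 →
      IsOpen {q : ℝ × ℝ | ⟪p, sphericalFrame b q 3⟫ ≠ 0} ∧
        Dense {q : ℝ × ℝ | ⟪p, sphericalFrame b q 3⟫ ≠ 0} := by
    intro p hp
    have hcont : Continuous fun q : ℝ × ℝ => ⟪p, sphericalFrame b q 3⟫ :=
      continuous_const.inner (continuous_sphericalFrame b 3)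
    refine ⟨isOpen_ne_fun hcont continuous_const, ?_⟩
    have hf : ∀ q : ℝ × ℝ, ⟪p, sphericalFrame b q 3⟫ =
        Real.sin q.1 * Real.cos q.2 * ⟪p, b 1⟫ + Real.sin q.1 * Real.sin q.2 * ⟪p, b 2⟫ +
          Real.cos q.1 * ⟪p, b 3⟫ := by
      intro q
      rw [coe_sphericalFrame]
      simp [inner_add_right, real_inner_smul_right]
    rw [← Set.compl_ofPred, ← interior_eq_empty_iff_dense_compl, Set.eq_empty_iff_forall_notMem]
    intro q₀ hq₀
    have hev : ∀ᶠ q in nhds q₀, ⟪p, sphericalFrame b q 3⟫ = 0 := mem_interior_iff_mem_nhds.1 hq₀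
    have hana : AnalyticOnNhd ℝ (fun q : ℝ × ℝ => ⟪p, sphericalFrame b q 3⟫) Set.univ := by
      intro q _
      simp only [hf]
      have h1 : AnalyticAt ℝ (fun q : ℝ × ℝ => q.1) q := analyticAt_fst
      have h2 : AnalyticAt ℝ (fun q : ℝ × ℝ => q.2) q := analyticAt_snd
      have hs : ∀ x, AnalyticAt ℝ Real.sin x := fun x => Real.analyticAt_sin
      have hc : ∀ x, AnalyticAt ℝ Real.cos x := fun x => Real.analyticAt_cos
      exact (((((hs _).comp h1).mul ((hc _).comp h2)).mul analyticAt_const).add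
        ((((hs _).comp h1).mul ((hs _).comp h2)).mul analyticAt_const)).add
        (((hc _).comp h1).mul analyticAt_const)
    have hzero := hana.eqOn_zero_of_preconnected_of_eventuallyEq_zero isPreconnected_univ
      (Set.mem_univ q₀) hev
    have e (q : ℝ × ℝ) := (hf q).symm.trans (hzero (Set.mem_univ q))
    have e3 := e (0, 0)
    have e1 := e (Real.pi / 2, 0)
    have e2 := e (Real.pi / 2, Real.pi / 2)
    simp at e1 e2 e3
    refine hp ?_
    conv_lhs => rw [← b.sum_repr' p]
    simp [Fin.sum_univ_four, real_inner_comm p, e1, e2, e3]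
  have := dense_biInter_of_isOpen (S := {p ∈ C | p ≠ ⟪p, b 0⟫ • b 0})
    (f := fun p => {q : ℝ × ℝ | ⟪p, sphericalFrame b q 3⟫ ≠ 0})
    (fun p hp => (key p hp.2).1) (hC.mono fun p hp => hp.1) (fun p hp => (key p hp.2).2)
  refine this.mono fun q hq p hp hpq => ?_
  by_contra hne
  exact Set.mem_iInter₂.1 hq p ⟨hp, hne⟩ hpq

/-- In the frame `F`, the motion `(c, v) ↦ (c - α, u v)` matches the sections of `K` and `L`. -/
def DirectMatch (F : Fin 4 → E4) (K L : Set E4) (α : ℝ) (u : Circle) : Prop :=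
  Carries F K L 1 (-α) (fun v => u * v) ∧ Carries F L K 1 α fun v => (u⁻¹ : Circle) * v

/-- In the frame `F`, the involution `(c, v) ↦ (β - c, u v̄)` matches the sections of `K` and
`L`. -/
def FlipMatch (F : Fin 4 → E4) (K L : Set E4) (β : ℝ) (u : Circle) : Prop :=
  Carries F K L (-1) β (fun v => u * starRingEnd ℂ v) ∧
    Carries F L K (-1) β fun v => u * starRingEnd ℂ v

lemma circle_mul_conj (u : Circle) : (u : ℂ) * starRingEnd ℂ (u : ℂ) = 1 := by
  rw [← Circle.coe_inv_eq_conj, ← Circle.coe_mul, mul_inv_cancel, Circle.coe_one]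

lemma inner_cyl_three (F : OrthonormalBasis (Fin 4) ℝ E4) (c : ℝ) (v : ℂ) :
    ⟪cyl F c v, F 3⟫ = 0 := by
  simp [inner_cyl]

lemma exists_directMatch {F : OrthonormalBasis (Fin 4) ℝ E4} {K L : Set E4} {φ : E4 ≃ₗᵢ[ℝ] E4}
    {α : ℝ} (hφ : IsRot (F 3) φ) (hm : MatchesSections (F 3) K L φ (α • F 0))
    (h0 : φ (F 0) = F 0) : ∃ u, DirectMatch F K L α u := by
  obtain ⟨u, h1, h2⟩ := exists_circle_of_isRot F hφ (ε := 1) (by norm_num) (by simpa)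
  have hcyl : ∀ c v, φ (cyl F c v) - α • F 0 = cyl F (c - α) (u * v) := by
    intro c v
    simp only [cyl, map_add, map_smul, h0, h1, h2, Complex.mul_re, Complex.mul_im]
    module
  refine ⟨u, fun c v hcv => ?_, fun c v hcv => ?_⟩
  · rwa [hm.2.2 _ (inner_cyl_three F c v), hcyl, ← one_mul c] at hcv
  · rw [hm.2.2 _ (inner_cyl_three F _ _), hcyl]
    rwa [← mul_assoc, ← Circle.coe_mul, mul_inv_cancel, Circle.coe_one, one_mul, one_mul,
      add_sub_cancel_right]

lemma exists_flipMatch {F : OrthonormalBasis (Fin 4) ℝ E4} {K L : Set E4} {φ : E4 ≃ₗᵢ[ℝ] E4}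
    {β : ℝ} (hφ : IsRot (F 3) φ) (hm : MatchesSections (F 3) K L φ (-β • F 0))
    (h0 : φ (F 0) = -F 0) : ∃ u, FlipMatch F K L β u := by
  obtain ⟨u, h1, h2⟩ := exists_circle_of_isRot F hφ (ε := -1) (by norm_num) (by simpa)
  have hcyl : ∀ c v, φ (cyl F c v) - -β • F 0 = cyl F (-1 * c + β) (u * starRingEnd ℂ v) := by
    intro c v
    simp only [cyl, map_add, map_smul, h0, h1, h2, Complex.mul_re, Complex.mul_im,
      Complex.conj_re, Complex.conj_im]
    module
  refine ⟨u, fun c v hcv => ?_, fun c v hcv => ?_⟩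
  · rwa [hm.2.2 _ (inner_cyl_three F c v), hcyl] at hcv
  · rw [hm.2.2 _ (inner_cyl_three F _ _), hcyl]
    rw [map_mul, Complex.conj_conj, ← mul_assoc, circle_mul_conj, one_mul]
    convert hcv using 1
    congr 1
    ring

lemma isClosed_setOf_exists_circle {X : Type*} [TopologicalSpace X] {P : X → Circle → Prop}
    (h : IsClosed {p : X × Circle | P p.1 p.2}) : IsClosed {x | ∃ u, P x u} := by
  convert isClosedMap_fst_of_compactSpace _ h using 1
  ext x
  simp

lemma continuous_circle_coe : Continuous ((↑) : Circle → ℂ) := by fun_prop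

lemma isClosed_directMatch (b : OrthonormalBasis (Fin 4) ℝ E4) {K L : Set E4} (hK : IsStarBody K)
    (hL : IsStarBody L) (α : ℝ) :
    IsClosed {p : (ℝ × ℝ) × Circle | DirectMatch (sphericalFrame b p.1) K L α p.2} := by
  have hF : ∀ i, Continuous fun p : (ℝ × ℝ) × Circle => sphericalFrame b p.1 i := fun i =>
    (continuous_sphericalFrame b i).comp continuous_fst
  refine (isClosed_carries hK hL.1.1.isClosed hF _ _ ?_).inter
    (isClosed_carries hL hK.1.1.isClosed hF _ _ ?_)
  · exact (continuous_circle_coe.comp (continuous_snd.comp continuous_fst)).mul continuous_snd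
  · exact (continuous_circle_coe.comp
      ((continuous_inv (G := Circle)).comp (continuous_snd.comp continuous_fst))).mul continuous_snd

lemma isClosed_flipMatch (b : OrthonormalBasis (Fin 4) ℝ E4) {K L : Set E4} (hK : IsStarBody K)
    (hL : IsStarBody L) (β : ℝ) :
    IsClosed {p : (ℝ × ℝ) × Circle | FlipMatch (sphericalFrame b p.1) K L β p.2} := by
  have hF : ∀ i, Continuous fun p : (ℝ × ℝ) × Circle => sphericalFrame b p.1 i := fun i =>
    (continuous_sphericalFrame b i).comp continuous_fst
  have hm : Continuous fun p : ((ℝ × ℝ) × Circle) × ℂ => (p.1.2 : ℂ) * starRingEnd ℂ p.2 :=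
    (continuous_circle_coe.comp (continuous_snd.comp continuous_fst)).mul
      (Complex.continuous_conj.comp continuous_snd)
  exact (isClosed_carries hK hL.1.1.isClosed hF _ _ hm).inter
    (isClosed_carries hL hK.1.1.isClosed hF _ _ hm)

lemma Carries.comp {F : Fin 4 → E4} {A B C : Set E4} {ε δ ε' δ' : ℝ} {m m' : ℂ → ℂ}
    (h' : Carries F B C ε' δ' m') (h : Carries F A B ε δ m) :
    Carries F A C (ε' * ε) (ε' * δ + δ') (m' ∘ m) := by
  intro c v hcv
  convert h' _ _ (h c v hcv) using 1
  rw [Function.comp_apply]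
  congr 1
  ring

lemma Carries.congr {F : Fin 4 → E4} {A B : Set E4} {ε δ ε' δ' : ℝ} {m m' : ℂ → ℂ}
    (h : Carries F A B ε δ m) (hε : ε = ε') (hδ : δ = δ') (hm : ∀ v, m v = m' v) :
    Carries F A B ε' δ' m' := by
  obtain rfl : m = m' := funext hm
  exact hε ▸ hδ ▸ h

lemma exists_hasPiSymSet_of_directMatch_of_flipMatch {F : OrthonormalBasis (Fin 4) ℝ E4}
    {K L : Set E4} {α β : ℝ} {u u' : Circle} (h : DirectMatch F K L α u)
    (h' : FlipMatch F K L β u') :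
    ∃ e ∈ S2 (F 0) ∩ S2 (F 3), HasPiSymSet (F 3) e (sect (F 3) K) := by
  refine exists_hasPiSymSet_of_carries_conj F (u' * u⁻¹) (δ := α + β)
    ((h'.2.comp h.1).congr (by norm_num) (by ring) fun v => ?_)
  simp only [Function.comp_apply, map_mul, Circle.coe_mul, Circle.coe_inv_eq_conj]
  ring

/-- The rotations about `F 0` that preserve the section of `K` by the hyperplane orthogonal to
`F 3`. -/
def rotationSymmetries (F : Fin 4 → E4) (K : Set E4) : Submonoid Circle where
  carrier := {g | Carries F K K 1 0 fun v => g * v}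
  one_mem' := fun c v h => by simpa using h
  mul_mem' := fun {g g'} h h' => (Carries.comp h h').congr (by norm_num) (by norm_num) fun v => by
    simp [mul_assoc]

lemma mem_rotationSymmetries_of_flipMatch {F : Fin 4 → E4} {K L : Set E4} {β : ℝ} {u u' : Circle}
    (h : FlipMatch F K L β u) (h' : FlipMatch F K L β u') : u' / u ∈ rotationSymmetries F K :=
  (h'.2.comp h.1).congr (by norm_num) (by ring) fun v => by
    simp [div_eq_mul_inv, ← Circle.coe_inv_eq_conj, mul_assoc]

lemma Carries.of_cyl_eq {F F' : Fin 4 → E4} {A B : Set E4} {ε δ : ℝ} {m m' : ℂ → ℂ}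
    (h : Carries F A B ε δ m) (g : Circle) (hF : ∀ c v, cyl F' c v = cyl F c (g * v))
    (hm : ∀ v, g * m' v = m (g * v)) : Carries F' A B ε δ m' := by
  intro c v hcv
  rw [hF] at hcv ⊢
  rw [hm]
  exact h _ _ hcv

lemma FlipMatch.of_cyl_eq {F F' : Fin 4 → E4} {K L : Set E4} {β : ℝ} {u : Circle} {g : Circle}
    (h : FlipMatch F K L β (g ^ 2 * u)) (hF : ∀ c v, cyl F' c v = cyl F c (g * v)) :
    FlipMatch F' K L β u := by
  have hm : ∀ v : ℂ, (g : ℂ) * (u * starRingEnd ℂ v) =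
      (g ^ 2 * u : Circle) * starRingEnd ℂ (g * v) := by
    intro v
    simp only [Circle.coe_mul, Circle.coe_pow, map_mul]
    linear_combination (-(g : ℂ) * u * starRingEnd ℂ v) * circle_mul_conj g
  exact ⟨h.1.of_cyl_eq g hF hm, h.2.of_cyl_eq g hF hm⟩

lemma flipMatch_iff_of_cyl_eq {F F' : Fin 4 → E4} {K L : Set E4} {β : ℝ} {u : Circle} {g : Circle}
    (hF : ∀ c v, cyl F' c v = cyl F c (g * v)) :
    FlipMatch F' K L β u ↔ FlipMatch F K L β (g ^ 2 * u) := by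
  refine ⟨fun h => ?_, fun h => h.of_cyl_eq hF⟩
  refine FlipMatch.of_cyl_eq (F := F') (g := g⁻¹) (by simpa using h) fun c v => ?_
  rw [hF, ← mul_assoc, ← Circle.coe_mul, mul_inv_cancel, Circle.coe_one, one_mul]

lemma cyl_sphericalFrame_zero (b : OrthonormalBasis (Fin 4) ℝ E4) (t c : ℝ) (v : ℂ) :
    cyl (sphericalFrame b (0, t)) c v = cyl (sphericalFrame b (0, 0)) c (Circle.exp t * v) := by
  simp only [cyl, coe_sphericalFrame, Circle.coe_exp, Complex.mul_re, Complex.mul_im,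
    Complex.exp_ofReal_mul_I_re, Complex.exp_ofReal_mul_I_im]
  simp
  module

lemma cyl_sphericalFrame_pi (b : OrthonormalBasis (Fin 4) ℝ E4) (t c : ℝ) (v : ℂ) :
    cyl (sphericalFrame b (Real.pi, t)) c v =
      cyl (sphericalFrame b (Real.pi, 0)) c (Circle.exp (-t) * v) := by
  simp only [cyl, coe_sphericalFrame, Circle.coe_exp, Complex.mul_re, Complex.mul_im,
    Complex.exp_ofReal_mul_I_re, Complex.exp_ofReal_mul_I_im]
  simp
  module

/-- A continuous field of flips over the whole sphere `S²(ζ)` would contradict the fact that the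
tangent bundle of the sphere is nontrivial. -/
lemma exists_not_flipMatch (b : OrthonormalBasis (Fin 4) ℝ E4) {K L : Set E4} (hK : IsStarBody K)
    (hL : IsStarBody L) (β : ℝ)
    (hsym : ∀ w ∈ S2 (b 0), ¬ HasPiSymSet w (b 0) (sect w K)) :
    ∃ q, ∀ u, ¬ FlipMatch (sphericalFrame b q) K L β u := by
  by_contra! hne
  refine false_of_coset_field {p | FlipMatch (sphericalFrame b p.1) K L β p.2}
    (isClosed_flipMatch b hK hL β) hne (fun q => rotationSymmetries (sphericalFrame b q) K)
    ?_ ?_ (fun q u u' h h' => mem_rotationSymmetries_of_flipMatch h h') ?_ ?_ ?_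
  · refine isClosed_carries hK hK.1.1.isClosed
      (F := fun p : (ℝ × ℝ) × Circle => sphericalFrame b p.1)
      (fun i => (continuous_sphericalFrame b i).comp continuous_fst) 1 0
      (m := fun p v => p.2 * v) ?_
    exact (continuous_circle_coe.comp (continuous_snd.comp continuous_fst)).mul continuous_snd
  · intro q hq
    have h0 : sphericalFrame b q 0 = b 0 := by rw [coe_sphericalFrame]; rfl
    refine hsym (sphericalFrame b q 3) ⟨mem_sphere_zero_iff_norm.2 (by simp), ?_⟩ ?_
    · rw [← h0, OrthonormalBasis.inner_eq_ite, if_neg (by decide)]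
    · rw [← h0]
      refine hasPiSymSet_of_carries_neg _ (Carries.congr hq rfl rfl fun v => ?_)
      simp [Circle.coe_exp]
  · intro s u
    have : (⇑(sphericalFrame b (s, 2 * Real.pi)) : Fin 4 → E4) = sphericalFrame b (s, 0) := by
      simp [coe_sphericalFrame]
    simp only [Set.mem_ofPred_eq, this]
  · intro t u
    simp only [Set.mem_ofPred_eq]
    rw [flipMatch_iff_of_cyl_eq (cyl_sphericalFrame_zero b t), two_mul, Circle.exp_add, sq]
  · intro t u
    simp only [Set.mem_ofPred_eq]
    rw [flipMatch_iff_of_cyl_eq (cyl_sphericalFrame_pi b t), two_mul, neg_add, Circle.exp_add, sq]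

lemma segment_add_subset_image_iff {L : Set E4} {a z y : E4} :
    segment ℝ (z + a) (y + a) ⊆ (fun x => x + a) '' L ↔ segment ℝ z y ⊆ L := by
  have : segment ℝ (z + a) (y + a) = (fun x => x + a) '' segment ℝ z y := by
    simpa [add_comm] using (segment_translate_image ℝ a z y).symm
  rw [this, Set.image_subset_image_iff (add_left_injective a)]

lemma chordSup_image_add (L : Set E4) (a : E4) : chordSup ((fun x => x + a) '' L) = chordSup L := by
  unfold chordSup
  congr 1
  ext d
  constructor
  · rintro ⟨z, y, h, rfl⟩
    refine ⟨z - a, y - a, ?_, by simp⟩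
    rwa [← segment_add_subset_image_iff (a := a), sub_add_cancel, sub_add_cancel]
  · rintro ⟨z, y, h, rfl⟩
    exact ⟨z + a, y + a, segment_add_subset_image_iff.2 h, by simp⟩

lemma IsDiamStar.image_add {L : Set E4} {z y : E4} (h : IsDiamStar L z y) (a : E4) :
    IsDiamStar ((fun x => x + a) '' L) (z + a) (y + a) :=
  ⟨segment_add_subset_image_iff.2 h.1, by rw [chordSup_image_add, dist_add_right, h.2]⟩

lemma IsDiamStar.swap {L : Set E4} {z y : E4} (h : IsDiamStar L z y) : IsDiamStar L y z :=
  ⟨by rw [segment_symm]; exact h.1, by rw [dist_comm, h.2]⟩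

lemma exists_orthonormalBasis_zero_eq {ζ : E4} (hζ : ‖ζ‖ = 1) :
    ∃ b : OrthonormalBasis (Fin 4) ℝ E4, b 0 = ζ := by
  have hon : Orthonormal ℝ (({0} : Set (Fin 4)).domRestrict fun _ => ζ) := by
    rw [orthonormal_iff_ite]
    rintro ⟨i, rfl⟩ ⟨j, rfl⟩
    simp [Set.domRestrict, hζ]
  obtain ⟨b, hb⟩ := hon.exists_orthonormalBasis_extension_of_card_eq (by simp)
  exact ⟨b, hb 0 rfl⟩

lemma sphericalFrame_zero (b : OrthonormalBasis (Fin 4) ℝ E4) (q : ℝ × ℝ) :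
    sphericalFrame b q 0 = b 0 := by
  rw [coe_sphericalFrame]
  rfl

lemma sphericalFrame_three_mem_S2 (b : OrthonormalBasis (Fin 4) ℝ E4) (q : ℝ × ℝ) :
    sphericalFrame b q 3 ∈ S2 (b 0) := by
  refine ⟨mem_sphere_zero_iff_norm.2 (by simp), ?_⟩
  rw [← sphericalFrame_zero b q, OrthonormalBasis.inner_eq_ite, if_neg (by decide)]

lemma exists_sphericalFrame_three_orthogonal (b : OrthonormalBasis (Fin 4) ℝ E4) (x : E4) :
    ∃ q, ⟪x, sphericalFrame b q 3⟫ = 0 := by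
  let v : ℂ := ⟨⟪x, b 1⟫, ⟪x, b 2⟫⟩
  refine ⟨(Real.pi / 2, v.arg + Real.pi / 2), ?_⟩
  have h1 : ‖v‖ * Real.cos v.arg = ⟪x, b 1⟫ := Complex.norm_mul_cos_arg v
  have h2 : ‖v‖ * Real.sin v.arg = ⟪x, b 2⟫ := Complex.norm_mul_sin_arg v
  rw [coe_sphericalFrame]
  simp [inner_add_right, real_inner_smul_right, Real.cos_add_pi_div_two, Real.sin_add_pi_div_two]
  rw [← h1, ← h2]
  ring

/-- For every frame whose last vector is orthogonal to no off-axis diameter of `L`, the congruence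
of the sections maps a diameter of `K` on the axis `ℝ (F 0)` to a diameter of `L` on that axis. -/
lemma exists_directMatch_or_flipMatch {F : OrthonormalBasis (Fin 4) ℝ E4} {K L : Set E4}
    (hK : StarShapedO K) (hc : chordSup L = chordSup K) (hD : 0 < chordSup K) {m : ℝ}
    (hz : m • F 0 ∈ K) (hy : (m + chordSup K) • F 0 ∈ K)
    (hcong : DirCong (F 3) (sect (F 3) K) (sect (F 3) L))
    (hdiam : ∀ z y, IsDiamStar L z y → ⟪z, F 3⟫ = 0 → z = ⟪z, F 0⟫ • F 0) :
    ∃ l : ℝ, l • F 0 ∈ L ∧ (l + chordSup L) • F 0 ∈ L ∧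
      ((∃ u, DirectMatch F K L (m - l) u) ∨ ∃ u, FlipMatch F K L (m + (l + chordSup L)) u) := by
  obtain ⟨φ, a, hφ, hm⟩ := hcong.exists_matchesSections
  rw [hc]
  set D := chordSup K
  have h03 : ∀ c : ℝ, ⟪c • F 0, F 3⟫ = 0 := by simp [real_inner_smul_left, F.inner_eq_ite]
  have hseg := hm.segment_subset (h03 m) (h03 (m + D)) (hK.segment_subset hz hy)
  have hperp : ∀ c : ℝ, ⟪φ (c • F 0) - a, F 3⟫ = 0 := fun c => by
    rw [inner_sub_left, inner_map_of_fixed hm.1, h03, hm.2.1, sub_zero]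
  have hd : IsDiamStar L (φ (m • F 0) - a) (φ ((m + D) • F 0) - a) :=
    ⟨hseg, by rw [dist_sub_right, φ.dist_map, dist_smul_smul (F.norm_eq_one 0), hc,
      add_sub_cancel_left, abs_of_pos hD]⟩
  have hz' := hdiam _ _ hd (hperp m)
  have hy' := hdiam _ _ hd.swap (hperp (m + D))
  have hzL := hseg (left_mem_segment ℝ _ _)
  have hyL := hseg (right_mem_segment ℝ _ _)
  have hdist := hd.2
  set l := ⟪φ (m • F 0) - a, F 0⟫
  set h := ⟪φ ((m + D) • F 0) - a, F 0⟫
  clear_value l h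
  rw [hz', hy', dist_smul_smul (F.norm_eq_one 0), hc] at hdist
  rw [hz'] at hzL
  rw [hy'] at hyL
  rw [map_smul] at hz' hy'
  have hφ0 : D • φ (F 0) = (h - l) • F 0 := by
    rw [sub_smul, ← hy', ← hz']
    module
  rcases (abs_eq hD.le).1 hdist with hhl | hhl
  · have h0 : φ (F 0) = F 0 := by
      rw [hhl] at hφ0
      exact smul_right_injective _ hD.ne' hφ0
    obtain rfl : h = l + D := by linarith
    obtain rfl : a = (m - l) • F 0 := by
      rw [sub_smul, ← hz', h0, sub_sub_cancel]
    exact ⟨l, hzL, hyL, .inl (exists_directMatch hφ hm h0)⟩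
  · have h0 : φ (F 0) = -F 0 := by
      rw [hhl, neg_smul, ← smul_neg] at hφ0
      exact smul_right_injective _ hD.ne' hφ0
    obtain rfl : l = h + D := by linarith
    obtain rfl : a = -(m + (h + D)) • F 0 := by
      rw [neg_smul, add_smul m, ← hz', h0]
      module
    exact ⟨h, hyL, hzL, .inr (exists_flipMatch hφ hm h0)⟩

lemma exists_forall_directMatch {b : OrthonormalBasis (Fin 4) ℝ E4} {K L : Set E4}
    (hK : IsStarBody K) (hL : IsStarBody L) (hLc : CountablyManyDiamsStar L)
    (hc : chordSup L = chordSup K) (hD : 0 < chordSup K) {m : ℝ}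
    (hz : m • b 0 ∈ K) (hy : (m + chordSup K) • b 0 ∈ K)
    (hcong : ∀ w ∈ S2 (b 0), DirCong w (sect w K) (sect w L))
    (hsym : ∀ w ∈ S2 (b 0), ¬ HasPiSymSet w (b 0) (sect w K) ∧
      ∀ u ∈ S2 (b 0) ∩ S2 w, ¬ HasPiSymSet w u (sect w K)) :
    ∃ l : ℝ, l • b 0 ∈ L ∧ (l + chordSup L) • b 0 ∈ L ∧
      ∀ q, ∃ u, DirectMatch (sphericalFrame b q) K L (m - l) u := by
  have hdense := dense_setOf_orthogonal_imp_axis b (hLc.image Prod.fst)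
  have key := fun q hq => exists_directMatch_or_flipMatch (F := sphericalFrame b q) hK.2.1 hc hD
    (m := m) (by rwa [sphericalFrame_zero]) (by rwa [sphericalFrame_zero])
    (hcong _ (sphericalFrame_three_mem_S2 b q)) hq
  simp only [sphericalFrame_zero] at key
  obtain ⟨q₀, hq₀⟩ := hdense.nonempty
  obtain ⟨l, hl, hl', -⟩ := key q₀ fun z y hzy => hq₀ z ⟨(z, y), hzy, rfl⟩
  refine ⟨l, hl, hl', ?_⟩
  set P : Set (ℝ × ℝ) := {q | ∃ u, DirectMatch (sphericalFrame b q) K L (m - l) u}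
  set N : Set (ℝ × ℝ) := {q | ∃ u, FlipMatch (sphericalFrame b q) K L (m + (l + chordSup L)) u}
  have hP : IsClosed P := isClosed_setOf_exists_circle (isClosed_directMatch b hK hL _)
  have hN : IsClosed N := isClosed_setOf_exists_circle (isClosed_flipMatch b hK hL _)
  have hPN : Set.univ ⊆ P ∪ N := by
    rw [← hdense.closure_eq]
    refine closure_minimal (fun q hq => ?_) (hP.union hN)
    obtain ⟨l', h1, h2, h⟩ := key q fun z y hzy => hq z ⟨(z, y), hzy, rfl⟩
    obtain rfl := eq_of_chords_of_maximal_length hL.1.1 hL.2.1 (b.norm_eq_one 0) h1 h2 hl hl'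
    exact h
  obtain ⟨q₁, hq₁⟩ := exists_not_flipMatch b hK hL (m + (l + chordSup L)) fun w hw => (hsym w hw).1
  have hq₁P : q₁ ∈ P := (hPN (Set.mem_univ q₁)).resolve_right fun ⟨u, hu⟩ => hq₁ u hu
  intro q
  refine (hPN (Set.mem_univ q)).resolve_right fun hqN => ?_
  obtain ⟨q₂, -, ⟨u, hu⟩, u', hu'⟩ := isPreconnected_closed_iff.1 isPreconnected_univ P N hP hN hPN
    ⟨q₁, Set.mem_univ _, hq₁P⟩ ⟨q, Set.mem_univ _, hqN⟩
  obtain ⟨e, he, hsymm⟩ := exists_hasPiSymSet_of_directMatch_of_flipMatch hu hu'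
  rw [sphericalFrame_zero] at he
  exact (hsym _ (sphericalFrame_three_mem_S2 b q₂)).2 e he hsymm

lemma starShapedO_image_add_of_directMatch {b : OrthonormalBasis (Fin 4) ℝ E4} {K L : Set E4}
    (hK : StarShapedO K) {α : ℝ} (h : ∀ q, ∃ u, DirectMatch (sphericalFrame b q) K L α u) :
    StarShapedO ((fun x => x + α • b 0) '' L) := by
  rintro _ ⟨x, hx, rfl⟩ t ht
  obtain ⟨q, hq⟩ := exists_sphericalFrame_three_orthogonal b x
  obtain ⟨u, hu⟩ := h q
  rw [← sphericalFrame_zero b q]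
  set F := sphericalFrame b q
  have hxF := eq_cyl_of_inner_eq_zero F x hq
  generalize ⟪x, F 0⟫ = c at hxF
  generalize (⟨⟪x, F 1⟫, ⟪x, F 2⟫⟩ : ℂ) = v at hxF
  subst hxF
  have h1 := hK _ (hu.2 c v hx) t ht
  rw [smul_cyl] at h1
  refine ⟨_, hu.1 _ _ h1, ?_⟩
  have hv : (u : ℂ) * (t * ((u⁻¹ : Circle) * v)) = t * v := by
    rw [Circle.coe_inv_eq_conj]
    linear_combination (t * v) * circle_mul_conj u
  simp only [hv, smul_add, smul_cyl]
  simp only [cyl]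
  module

/-- Lemma: there is a translation of `L` along `ζ` which is
star-shaped with respect to the origin and whose diameter coincides with `d_K(ζ)`. -/
theorem stmt_16 (K L : Set E4) (hK : IsStarBody K) (hL : IsStarBody L)
    (hKc : CountablyManyDiamsStar K) (hLc : CountablyManyDiamsStar L)
    (ζ : E4) (hζ : ζ ∈ sph)
    (hd : ∃ z y : E4, IsDiamStar K z y ∧ (0 : E4) ∈ segment ℝ z y ∧
      ∃ s : ℝ, s ≠ 0 ∧ y - z = s • ζ)
    (hcong : ∀ w ∈ S2 ζ, DirCong w (sect w K) (sect w L))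
    (hsym : ∀ w ∈ S2 ζ,
      (¬ HasPiSymSet w ζ (sect w K) ∧ ¬ HasPiSymSet w ζ (sect w L)) ∧
      ∀ u ∈ S2 ζ ∩ S2 w, ¬ HasPiSymSet w u (sect w K) ∧ ¬ HasPiSymSet w u (sect w L)) :
    ∃ a : E4, (∃ s : ℝ, a = s • ζ) ∧ StarShapedO ((fun x => x + a) '' L) ∧
      ∃ z y : E4, IsDiamStar K z y ∧ (0 : E4) ∈ segment ℝ z y ∧
        (∃ s : ℝ, s ≠ 0 ∧ y - z = s • ζ) ∧ IsDiamStar ((fun x => x + a) '' L) z y := by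
  have hζ1 : ‖ζ‖ = 1 := mem_sphere_zero_iff_norm.1 hζ
  obtain ⟨z, y, hzy, h0, s, hs, hys⟩ : ∃ z y : E4, IsDiamStar K z y ∧ (0 : E4) ∈ segment ℝ z y ∧
      ∃ s : ℝ, 0 < s ∧ y - z = s • ζ := by
    obtain ⟨z, y, hzy, h0, s, hs, hys⟩ := hd
    rcases hs.lt_or_gt with hs | hs
    · refine ⟨y, z, hzy.swap, by rwa [segment_symm], -s, neg_pos.2 hs, ?_⟩
      rw [neg_smul, ← hys, neg_sub]
    · exact ⟨z, y, hzy, h0, s, hs, hys⟩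
  have hsD : s = chordSup K := by
    rw [← hzy.2, dist_comm, dist_eq_norm, hys, norm_smul, hζ1, mul_one, Real.norm_of_nonneg hs.le]
  obtain ⟨m, rfl⟩ : ∃ m : ℝ, z = m • ζ := by
    obtain ⟨p, q, -, -, hpq, h⟩ := h0
    refine ⟨-(q * s), ?_⟩
    have hz : (p + q) • z = z := by rw [hpq, one_smul]
    rw [neg_smul, mul_smul, ← hys, eq_neg_iff_add_eq_zero, ← h]
    nth_rw 1 [← hz]
    module
  obtain rfl : y = (m + s) • ζ := by rw [add_smul, ← hys, add_sub_cancel]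
  obtain ⟨b, rfl⟩ := exists_orthonormalBasis_zero_eq hζ1
  subst hsD
  have hmatch : ∀ w ∈ S2 (b 0), ∃ φ a, MatchesSections w K L φ a := fun w hw =>
    let ⟨φ, a, _, h⟩ := (hcong w hw).exists_matchesSections
    ⟨φ, a, h⟩
  have hc : chordSup L = chordSup K :=
    le_antisymm
      (chordSup_le_of_forall_matchesSections hK.1.1 ⟨0, hL.zero_mem⟩ fun w hw =>
        let ⟨_, _, h⟩ := hmatch w hw
        ⟨_, _, h.symm⟩)
      (chordSup_le_of_forall_matchesSections hL.1.1 ⟨0, hK.zero_mem⟩ hmatch)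
  obtain ⟨l, hl, hl', hu⟩ := exists_forall_directMatch hK hL hLc hc hs
    (hzy.1 (left_mem_segment ℝ _ _)) (hzy.1 (right_mem_segment ℝ _ _)) hcong fun w hw =>
      ⟨(hsym w hw).1.1, fun u hu => ((hsym w hw).2 u hu).1⟩
  refine ⟨(m - l) • b 0, ⟨_, rfl⟩, starShapedO_image_add_of_directMatch hK.2.1 hu, _, _, hzy, h0,
    ⟨_, hs.ne', hys⟩, ?_⟩
  have hdL : IsDiamStar L (l • b 0) ((l + chordSup L) • b 0) :=
    ⟨hL.2.1.segment_subset hl hl', by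
      rw [dist_smul_smul hζ1, add_sub_cancel_left, hc, abs_of_pos hs]⟩
  convert hdL.image_add ((m - l) • b 0) using 1
  · module
  · rw [hc]
    module
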